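/- Let f : X → X be monotone and non-expansive with at least one fixpoint, let ((α_n),(β_n)) be a Mann scheme, let x_0 ∈ X, and let (x_n) be the dampened Mann iteration with the constant function sequence f_n = f. If (x_n) is asymptotically regular with respect to f, i.e. lim_{n→∞} ‖x_n − f(x_n)‖ = 0, then (x_n) converges to the least fixpoint μf of f. -/

import Mathlib

open Filter Set Topology

/-- The dampened Mann iteration:
`x₀ = x0`, `x_{n+1} = (1 - β n) • (α n • x n + (1 - α n) • f n (x n))`. -/
noncomputable def mannSeq {E : Type*} [AddCommGroup E] [Module ℝ E]
    (α β : ℕ → ℝ) (f : ℕ → E → E) (x0 : E) : ℕ → E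
  | 0 => x0
  | n + 1 => (1 - β n) • (α n • mannSeq α β f x0 n + (1 - α n) • f n (mannSeq α β f x0 n))

/-- If `a (n + 1) ≤ max ε ((1 - β n) * a n)` from some point on and `Σ β n = ∞`, then the
nonnegative sequence `a` is eventually at most `ε`. -/
theorem eventually_le_of_le_max_one_sub_mul {a β : ℕ → ℝ} {ε : ℝ} {N : ℕ} (hε : 0 < ε)
    (ha : ∀ n, 0 ≤ a n) (hβ : ∀ n, 0 ≤ β n) (hβdiv : ¬ Summable β)
    (hstep : ∀ n, N ≤ n → a (n + 1) ≤ max ε ((1 - β n) * a n)) :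
    ∀ᶠ n in atTop, a n ≤ ε := by
  by_cases h : ∃ m, N ≤ m ∧ a m ≤ ε
  · obtain ⟨m, hNm, hm⟩ := h
    filter_upwards [eventually_ge_atTop m] with n hn
    induction n, hn using Nat.le_induction with
    | base => exact hm
    | succ k hk ih =>
      refine (hstep k (hNm.trans hk)).trans (max_le le_rfl ?_)
      nlinarith [mul_nonneg (hβ k) (ha k)]
  · push Not at h
    have hdecr : ∀ n, N ≤ n → a (n + 1) ≤ a n - ε * β n := by
      intro n hn
      rcases le_max_iff.1 (hstep n hn) with h1 | h1
      · exact absurd h1 (h (n + 1) (by omega)).not_ge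
      · nlinarith [mul_le_mul_of_nonneg_left (h n hn).le (hβ n)]
    have hsum : ∀ n, ε * ∑ k ∈ Finset.range n, β (k + N) ≤ a N - a (n + N) := by
      intro n
      induction n with
      | zero => simp
      | succ k ih =>
        have := hdecr (k + N) (by omega)
        rw [Finset.sum_range_succ, mul_add, show k + 1 + N = k + N + 1 by omega]
        linarith
    refine absurd ((summable_nat_add_iff N).1 ?_) hβdiv
    refine summable_of_sum_range_le (c := a N / ε) (fun n => hβ _) fun n => ?_
    rw [le_div_iff₀ hε]
    linarith [hsum n, ha (n + N)]

theorem mannSeq_mem {E : Type*} [AddCommGroup E] [Module ℝ E] {α β : ℕ → ℝ} {f : ℕ → E → E}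
    {x0 : E} {X : Set E} (hα : ∀ n, α n ∈ Set.Ico (0 : ℝ) 1) (hβ : ∀ n, β n ∈ Set.Ico (0 : ℝ) 1)
    (hXc : Convex ℝ X) (h0 : (0 : E) ∈ X) (hmap : ∀ n, Set.MapsTo (f n) X X) (hx0 : x0 ∈ X)
    (n : ℕ) : mannSeq α β f x0 n ∈ X := by
  induction n with
  | zero => exact hx0
  | succ n ih =>
    have h := hXc ih (hmap n ih) (hα n).1 (sub_nonneg.2 (hα n).2.le) (by ring)
    exact hXc.smul_mem_of_zero_mem h0 h ⟨by linarith [(hβ n).2], by linarith [(hβ n).1]⟩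

/-- The undamped step of the Mann iteration does not move away from a fixpoint. -/
theorem LipschitzOnWith.norm_convexComb_sub_fixpoint_le {E : Type*} [NormedAddCommGroup E]
    [NormedSpace ℝ E] {f : E → E} {X : Set E} (hne : LipschitzOnWith 1 f X) {p x : E}
    (hp : p ∈ X) (hfp : f p = p) (hx : x ∈ X) {a : ℝ} (ha : a ∈ Set.Ico (0 : ℝ) 1) :
    ‖a • x + (1 - a) • f x - p‖ ≤ ‖x - p‖ := by
  have h : ‖f x - p‖ ≤ ‖x - p‖ := by
    simpa [hfp, dist_eq_norm] using hne.dist_le_mul x hx p hp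
  have h1 : 0 ≤ 1 - a := by linarith [ha.2]
  calc ‖a • x + (1 - a) • f x - p‖ = ‖a • (x - p) + (1 - a) • (f x - p)‖ := by
        congr 1; module
    _ ≤ a * ‖x - p‖ + (1 - a) * ‖f x - p‖ := by
        refine (norm_add_le _ _).trans_eq ?_
        rw [norm_smul_of_nonneg ha.1, norm_smul_of_nonneg h1]
    _ ≤ a * ‖x - p‖ + (1 - a) * ‖x - p‖ := by gcongr
    _ = ‖x - p‖ := by ring

/-- A bounded asymptotically regular sequence is eventually almost above any lower bound of the
fixpoints. -/
theorem eventually_sub_lt_of_asymptotically_regular {ι : Type*} [Fintype ι] {X : Set (ι → ℝ)}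
    (hX : IsClosed X) {f : (ι → ℝ) → (ι → ℝ)} (hf : ContinuousOn f X) {μ : ι → ℝ}
    (hμ : ∀ z ∈ X, f z = z → μ ≤ z) {x : ℕ → ι → ℝ} (hx : ∀ n, x n ∈ X) {R : ℝ}
    (hR : ∀ n, ‖x n - μ‖ ≤ R) (hreg : Tendsto (fun n => ‖x n - f (x n)‖) atTop (nhds 0))
    {ε : ℝ} (hε : 0 < ε) : ∀ᶠ n in atTop, ∀ i, μ i - ε < x n i := by
  by_contra hcon
  have hfreq : ∃ᶠ n in atTop,
      x n ∈ (Metric.closedBall μ R ∩ X) ∩ ⋃ i, {z : ι → ℝ | z i ≤ μ i - ε} := by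
    refine (not_eventually.1 hcon).mono fun n hn => ⟨⟨?_, hx n⟩, ?_⟩
    · simpa [dist_eq_norm] using hR n
    · push Not at hn
      simpa using hn
  have hcpt : IsCompact ((Metric.closedBall μ R ∩ X) ∩ ⋃ i, {z : ι → ℝ | z i ≤ μ i - ε}) :=
    ((isCompact_closedBall μ R).inter_right hX).inter_right <|
      isClosed_iUnion_of_finite fun i => isClosed_le (continuous_apply i) continuous_const
  obtain ⟨z, ⟨⟨-, hzX⟩, hzi⟩, φ, hφ, hlim⟩ := hcpt.tendsto_subseq' hfreq
  have hflim : Tendsto (fun n => f (x (φ n))) atTop (nhds (f z)) :=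
    (hf z hzX).tendsto.comp
      (tendsto_nhdsWithin_iff.2 ⟨hlim, Eventually.of_forall fun n => hx (φ n)⟩)
  have hz : ‖z - f z‖ = 0 :=
    tendsto_nhds_unique ((Tendsto.sub hlim hflim).norm) (hreg.comp hφ.tendsto_atTop)
  have hle := hμ z hzX (sub_eq_zero.1 (norm_eq_zero.1 hz)).symm
  obtain ⟨i, hi⟩ := Set.mem_iUnion.1 hzi
  have : z i ≤ μ i - ε := hi
  linarith [hle i]

/-- for a Mann scheme (`α n, β n ∈ [0,1)`, `β n → 0`, `Σ β n = ∞`),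
if the dampened Mann iteration with constant function sequence `f` is
asymptotically regular with respect to `f`, then it converges to the least
fixpoint of `f`. -/
theorem asymptotically_regular_converges_to_lfp
    (α β : ℕ → ℝ) (hα : ∀ n, α n ∈ Set.Ico (0 : ℝ) 1) (hβ : ∀ n, β n ∈ Set.Ico (0 : ℝ) 1)
    (hβ0 : Tendsto β atTop (nhds 0)) (hβdiv : ¬ Summable β)
    (d : ℕ) (X : Set (Fin d → ℝ)) (hX : IsClosed X) (hXc : Convex ℝ X)
    (hpos : ∀ x ∈ X, ∀ i, 0 ≤ x i) (h0 : (0 : Fin d → ℝ) ∈ X)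
    (f : (Fin d → ℝ) → (Fin d → ℝ)) (hmap : Set.MapsTo f X X)
    (hmono : ∀ x ∈ X, ∀ y ∈ X, x ≤ y → f x ≤ f y)
    (hne : LipschitzOnWith 1 f X)
    (hfix : ∃ x ∈ X, f x = x)
    (μ : Fin d → ℝ) (hμ : IsLeast {x | x ∈ X ∧ f x = x} μ)
    (x0 : Fin d → ℝ) (hx0 : x0 ∈ X)
    (hreg : Tendsto
      (fun n => ‖mannSeq α β (fun _ => f) x0 n - f (mannSeq α β (fun _ => f) x0 n)‖)
      atTop (nhds 0)) :
    Tendsto (mannSeq α β (fun _ => f) x0) atTop (nhds μ) := by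
  set x := mannSeq α β (fun _ => f) x0 with hxdef
  obtain ⟨⟨hμX, hfμ⟩, hμle⟩ := hμ
  have hxX : ∀ n, x n ∈ X := mannSeq_mem hα hβ hXc h0 (fun _ => hmap) hx0
  let y : ℕ → Fin d → ℝ := fun n => α n • x n + (1 - α n) • f (x n)
  have hsucc : ∀ n, x (n + 1) = (1 - β n) • y n := fun n => rfl
  have hy : ∀ n, ‖y n - μ‖ ≤ ‖x n - μ‖ := fun n =>
    hne.norm_convexComb_sub_fixpoint_le hμX hfμ (hxX n) (hα n)
  have hbdd : ∀ n, ‖x n - μ‖ ≤ max ‖x0 - μ‖ ‖μ‖ := by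
    intro n
    induction n with
    | zero => exact le_max_left _ _
    | succ n ih =>
      have h1 : 0 ≤ 1 - β n := by linarith [(hβ n).2]
      calc ‖x (n + 1) - μ‖ = ‖(1 - β n) • (y n - μ) - β n • μ‖ := by
            rw [hsucc]; congr 1; module
        _ ≤ (1 - β n) * ‖y n - μ‖ + β n * ‖μ‖ := by
            refine (norm_sub_le _ _).trans_eq ?_
            rw [norm_smul_of_nonneg h1, norm_smul_of_nonneg (hβ n).1]
        _ ≤ (1 - β n) * max ‖x0 - μ‖ ‖μ‖ + β n * max ‖x0 - μ‖ ‖μ‖ := by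
            have := (hβ n).1
            gcongr
            · exact (hy n).trans ih
            · exact le_max_right _ _
        _ = max ‖x0 - μ‖ ‖μ‖ := by ring
  rw [tendsto_iff_norm_sub_tendsto_zero, Metric.tendsto_nhds]
  intro δ hδ
  obtain ⟨N, hN⟩ := eventually_atTop.1 <|
    eventually_sub_lt_of_asymptotically_regular hX hne.continuousOn
      (fun z hz hfz => hμle ⟨hz, hfz⟩) hxX hbdd hreg (half_pos hδ)
  have hstep : ∀ n, N ≤ n →
      ‖x (n + 1) - μ‖ ≤ max (δ / 2) ((1 - β n) * ‖x n - μ‖) := by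
    intro n hn
    refine (pi_norm_le_iff_of_nonneg (le_max_of_le_left (half_pos hδ).le)).2 fun i => ?_
    rw [Real.norm_eq_abs, abs_le]
    constructor
    · have := hN (n + 1) (by omega) i
      have := le_max_left (δ / 2) ((1 - β n) * ‖x n - μ‖)
      simp only [Pi.sub_apply]
      linarith
    · refine le_max_of_le_right ?_
      have hyi : y n i - μ i ≤ ‖x n - μ‖ :=
        ((le_abs_self _).trans (norm_le_pi_norm (y n - μ) i)).trans (hy n)
      have hμi := mul_nonneg (hβ n).1 (hpos μ hμX i)
      have := mul_le_mul_of_nonneg_left hyi (sub_nonneg.2 (hβ n).2.le)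
      simp only [hsucc, Pi.sub_apply, Pi.smul_apply, smul_eq_mul]
      linarith
  filter_upwards [eventually_le_of_le_max_one_sub_mul (half_pos hδ)
    (fun n => norm_nonneg (x n - μ))
    (fun n => (hβ n).1) hβdiv hstep] with n hn
  rw [dist_zero_right, norm_norm]
  linarith
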